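/- Let n ≥ 1, let A be an n×n real matrix, and let X ∈ SO(n) be a minimizer of the Frobenius norm ‖Y − A‖_F over Y ∈ SO(n) (i.e., ‖X − A‖_F ≤ ‖Y − A‖_F for all Y ∈ SO(n)). Then the matrix Aᵀ X is symmetric. -/

import Mathlib

open Matrix BigOperators

/-- Frobenius norm of a real square matrix. -/
noncomputable def frobNorm {n : ℕ} (M : Matrix (Fin n) (Fin n) ℝ) : ℝ :=
  Real.sqrt (∑ i, ∑ j, (M i j) ^ 2)

/-- Membership in the special orthogonal group `SO(n)`. -/
def IsSO {n : ℕ} (X : Matrix (Fin n) (Fin n) ℝ) : Prop :=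
  Xᵀ * X = 1 ∧ X * Xᵀ = 1 ∧ X.det = 1

theorem frobNorm_sq_aux {n : ℕ} (M : Matrix (Fin n) (Fin n) ℝ) :
    ∑ i, ∑ j, (M i j) ^ 2 = (Mᵀ * M).trace := by
  rw [Finset.sum_comm]
  simp [Matrix.trace, Matrix.mul_apply, sq]

theorem frob_expand_aux {n : ℕ} (A Y : Matrix (Fin n) (Fin n) ℝ) (hY : Yᵀ * Y = 1) :
    ((Y - A)ᵀ * (Y - A)).trace = (1 : Matrix (Fin n) (Fin n) ℝ).trace
      - 2 * (Aᵀ * Y).trace + (Aᵀ * A).trace := by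
  have h : (Yᵀ * A).trace = (Aᵀ * Y).trace := by
    rw [← Matrix.trace_transpose, Matrix.transpose_mul, Matrix.transpose_transpose]
  rw [Matrix.transpose_sub, Matrix.sub_mul, Matrix.mul_sub, Matrix.mul_sub, hY]
  simp only [Matrix.trace_sub, h]
  ring

theorem trace_le_aux {n : ℕ} (A X Y : Matrix (Fin n) (Fin n) ℝ) (hX : Xᵀ * X = 1)
    (hY : Yᵀ * Y = 1) (h : frobNorm (X - A) ≤ frobNorm (Y - A)) :
    (Aᵀ * Y).trace ≤ (Aᵀ * X).trace := by
  unfold frobNorm at h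
  rw [Real.sqrt_le_sqrt_iff (by positivity), frobNorm_sq_aux, frobNorm_sq_aux,
    frob_expand_aux A X hX, frob_expand_aux A Y hY] at h
  linarith

/-- Algebra of a rotation generated by `K` with `K ^ 3 = -K`. -/
theorem rot_aux {n : ℕ} (K P : Matrix (Fin n) (Fin n) ℝ) (hP : K * K = P)
    (hKP : K * P = -K) (c s : ℝ) (hcs : c ^ 2 + s ^ 2 = 1) :
    (1 - s • K + (1 - c) • P) * (1 + s • K + (1 - c) • P) = 1 ∧
    (1 + s • K + (1 - c) • P) * (1 + s • K + (1 - c) • P)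
      = 1 + (2 * s * c) • K + (2 * s ^ 2) • P := by
  have hPK : P * K = -K := by rw [← hKP, ← hP, Matrix.mul_assoc]
  have hPP : P * P = -P := by
    nth_rewrite 1 [← hP]
    rw [Matrix.mul_assoc, hKP, Matrix.mul_neg, hP]
  have hs : s ^ 2 = 1 - c ^ 2 := by linarith
  constructor
  · simp only [add_mul, sub_mul, mul_add, one_mul, mul_one, smul_mul_assoc, mul_smul_comm,
      hP, hKP, hPK, hPP, smul_neg, smul_smul]
    have : (2 - 2 * c - s * s - (1 - c) * (1 - c)) • P = 0 := by
      rw [show (2 - 2 * c - s * s - (1 - c) * (1 - c)) = 0 by nlinarith, zero_smul]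
    rw [← sub_eq_zero, ← this]
    module
  · rw [hs]
    simp only [add_mul, mul_add, one_mul, mul_one, smul_mul_assoc, mul_smul_comm,
      hP, hKP, hPK, hPP, smul_neg, smul_smul]
    have : (s * s - (1 - c ^ 2)) • P = 0 := by
      rw [show s * s - (1 - c ^ 2) = 0 by nlinarith, zero_smul]
    rw [← sub_eq_zero, ← this]
    module

theorem IsSO_of_sq_aux {n : ℕ} (X Q : Matrix (Fin n) (Fin n) ℝ) (hX : IsSO X)
    (hQ : Qᵀ * Q = 1) : IsSO (X * (Q * Q)) := by
  have h1 : (X * (Q * Q))ᵀ * (X * (Q * Q)) = 1 := by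
    simp only [Matrix.transpose_mul]
    calc Qᵀ * Qᵀ * Xᵀ * (X * (Q * Q)) = Qᵀ * (Qᵀ * (Xᵀ * X) * Q) * Q := by
          simp only [Matrix.mul_assoc]
      _ = 1 := by rw [hX.1, Matrix.mul_one, hQ, Matrix.mul_one, hQ]
  refine ⟨h1, mul_eq_one_comm.mp h1, ?_⟩
  have := congrArg Matrix.det hQ
  rw [Matrix.det_mul, Matrix.det_transpose, Matrix.det_one] at this
  rw [Matrix.det_mul, Matrix.det_mul, hX.2.2, this, one_mul]

theorem quad_aux (a b : ℝ) (h : ∀ t : ℝ, t * a + t ^ 2 * b ≤ 0) : a = 0 := by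
  have hb : 0 < |b| + 1 := by positivity
  have h1 := h (a / (|b| + 1))
  have h2 : a / (|b| + 1) * a + (a / (|b| + 1)) ^ 2 * b
      = a ^ 2 * (|b| + 1 + b) / (|b| + 1) ^ 2 := by
    field_simp
  rw [h2, div_le_iff₀ (by positivity), zero_mul] at h1
  have h3 : 0 < |b| + 1 + b := by linarith [neg_abs_le b]
  have : a ^ 2 ≤ 0 := by
    by_contra hc
    push Not at hc
    nlinarith [mul_pos hc h3]
  exact pow_eq_zero_iff two_ne_zero |>.mp (le_antisymm this (sq_nonneg a))

/-- If `X ∈ SO(n)` minimizes the Frobenius distance to `A` over `SO(n)`,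
then `Aᵀ X` is symmetric. -/
theorem symm_of_minimizer_over_SO (n : ℕ) (hn : 1 ≤ n)
    (A X : Matrix (Fin n) (Fin n) ℝ) (hX : IsSO X)
    (hmin : ∀ Y : Matrix (Fin n) (Fin n) ℝ, IsSO Y → frobNorm (X - A) ≤ frobNorm (Y - A)) :
    (Aᵀ * X).IsSymm := by
  ext i j
  rw [Matrix.transpose_apply]
  by_cases hij : i = j
  · rw [hij]
  set K : Matrix (Fin n) (Fin n) ℝ := Matrix.single i j 1 - Matrix.single j i 1 with hK
  have hji : j ≠ i := fun h => hij h.symm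
  have hKt : Kᵀ = -K := by simp [hK]
  have hKP : K * (K * K) = -K := by
    simp [hK, sub_mul, mul_sub, hij, hji]
    abel
  have hPt : (K * K)ᵀ = K * K := by simp [Matrix.transpose_mul, hKt]
  have key : ((Aᵀ * X) * K).trace = 0 := by
    apply quad_aux _ ((Aᵀ * X) * (K * K)).trace
    intro t
    have hpos : 0 < 1 + t ^ 2 := by positivity
    obtain ⟨c, hc⟩ : ∃ c : ℝ, c ^ 2 = (1 + t ^ 2)⁻¹ :=
      ⟨Real.sqrt (1 + t ^ 2)⁻¹, Real.sq_sqrt (by positivity)⟩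
    have hc2 : c ^ 2 * (1 + t ^ 2) = 1 := by rw [hc]; exact inv_mul_cancel₀ hpos.ne'
    have hc0 : 0 < c ^ 2 := by rw [hc]; positivity
    obtain ⟨r1, r2⟩ := rot_aux K (K * K) rfl hKP c (t * c) (by linarith)
    have hQ : (1 + (t * c) • K + (1 - c) • (K * K))ᵀ *
        (1 + (t * c) • K + (1 - c) • (K * K)) = 1 := by
      refine Eq.trans ?_ r1
      congr 1
      rw [Matrix.transpose_add, Matrix.transpose_add, Matrix.transpose_smul,
        Matrix.transpose_smul, hPt, hKt, Matrix.transpose_one, smul_neg, ← sub_eq_add_neg]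
    have hSO := IsSO_of_sq_aux X _ hX hQ
    have hle := trace_le_aux A X _ hX.1 hSO.1 (hmin _ hSO)
    rw [r2, ← Matrix.mul_assoc, Matrix.mul_add, Matrix.mul_add, Matrix.mul_one,
      Matrix.mul_smul, Matrix.mul_smul, Matrix.trace_add, Matrix.trace_add,
      Matrix.trace_smul, Matrix.trace_smul, smul_eq_mul, smul_eq_mul] at hle
    by_contra hcon
    push Not at hcon
    nlinarith [mul_pos hc0 hcon]
  rw [hK, Matrix.mul_sub, Matrix.trace_sub, Matrix.trace_mul_single, Matrix.trace_mul_single] at key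
  simp at key
  linarith
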